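/- Let γ > 0 and 0 ≤ a < γ/2, and let B ⊆ ℝ be a Borel set. Then sup over all x with |x| ≤ a t of | ∫_B p(t; x, y) · 2 e^{-2γ|y|} dy − ∫_B γ e^{-2γ|y|} dy | → 0 as t → ∞, where p(t; x, y) = (1/(2√(2πt))) exp( γ(|x| + |y|) − (γ²/2) t − (x − y)²/(2t) ) + (γ/4) Erfc( (|x| + |y| − γt)/√(2t) ). -/

import Mathlib

open MeasureTheory Real Set Filter

/-- The complementary error function `Erfc`. -/
noncomputable def erfc (x : ℝ) : ℝ :=
  (2 / Real.sqrt Real.pi) * ∫ u in Set.Ioi x, Real.exp (-u ^ 2)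

/-- The transition density `p(t; x, y)`, with respect to the speed measure
`m(dy) = 2 e^{-2γ|y|} dy`, of a Brownian motion with constant drift `γ` towards the origin. -/
noncomputable def transDensity (γ t x y : ℝ) : ℝ :=
  (1 / (2 * Real.sqrt (2 * Real.pi * t))) *
      Real.exp (γ * (|x| + |y|) - γ ^ 2 / 2 * t - (x - y) ^ 2 / (2 * t)) +
    (γ / 4) * erfc ((|x| + |y| - γ * t) / Real.sqrt (2 * t))

lemma erfc_gauss_int : Integrable (fun u : ℝ => Real.exp (-u ^ 2)) := by
  simpa using integrable_exp_neg_mul_sq (b := 1) one_pos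

lemma erfc_gauss_total : ∫ u : ℝ, Real.exp (-u ^ 2) = Real.sqrt Real.pi := by
  simpa using integral_gaussian 1

lemma erfc_two_sub (z : ℝ) :
    2 - erfc z = (2 / Real.sqrt Real.pi) * ∫ u in Set.Iic z, Real.exp (-u ^ 2) := by
  have h := intervalIntegral.integral_Iic_add_Ioi (b := z) (μ := volume)
    erfc_gauss_int.integrableOn erfc_gauss_int.integrableOn
  rw [erfc_gauss_total] at h
  have hp : 0 < Real.sqrt Real.pi := Real.sqrt_pos.2 Real.pi_pos
  unfold erfc
  have : ∫ u in Set.Iic z, Real.exp (-u ^ 2) =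
    Real.sqrt Real.pi - ∫ u in Set.Ioi z, Real.exp (-u ^ 2) := by linarith
  rw [this]
  field_simp

lemma erfc_two_sub_nonneg (z : ℝ) : 0 ≤ 2 - erfc z := by
  rw [erfc_two_sub]
  exact mul_nonneg (by positivity) (integral_nonneg fun u => (Real.exp_pos _).le)

lemma erfc_nonneg (z : ℝ) : 0 ≤ erfc z := by
  unfold erfc
  exact mul_nonneg (by positivity) (integral_nonneg fun u => (Real.exp_pos _).le)

lemma erfc_antitone : Antitone erfc := by
  intro x y hxy
  unfold erfc
  refine mul_le_mul_of_nonneg_left ?_ (by positivity)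
  exact setIntegral_mono_set erfc_gauss_int.integrableOn
    (Eventually.of_forall fun u => (Real.exp_pos _).le)
    (Eventually.of_forall (Set.Ioi_subset_Ioi hxy))

lemma erfc_two_sub_le (z : ℝ) :
    2 - erfc z ≤ (2 / Real.sqrt Real.pi * Real.exp (1 / 4)) * Real.exp z := by
  rw [erfc_two_sub, mul_assoc]
  refine mul_le_mul_of_nonneg_left ?_ (by positivity)
  calc ∫ u in Set.Iic z, Real.exp (-u ^ 2)
      ≤ ∫ u in Set.Iic z, Real.exp (1 / 4) * Real.exp u := by
        refine integral_mono erfc_gauss_int.integrableOn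
          ((integrableOn_exp_Iic z).const_mul _) ?_
        intro u
        simp only [← Real.exp_add]
        exact Real.exp_le_exp.2 (by nlinarith [sq_nonneg (u + 1 / 2)])
    _ = _ := by rw [integral_const_mul, integral_exp_Iic]

lemma integrable_exp_neg_abs' {c : ℝ} (hc : 0 < c) :
    Integrable (fun y : ℝ => Real.exp (-c * |y|)) := by
  rw [← integrableOn_univ, ← Set.Iic_union_Ioi (a := (0 : ℝ))]
  refine IntegrableOn.union ?_ ?_
  · refine (integrableOn_exp_mul_Iic hc 0).congr_fun ?_ measurableSet_Iic
    intro y hy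
    simp only [abs_of_nonpos (Set.mem_Iic.1 hy)]
    congr 1; ring
  · refine (integrableOn_exp_mul_Ioi (a := -c) (by linarith) 0).congr_fun ?_ measurableSet_Ioi
    intro y hy
    simp only [abs_of_pos (Set.mem_Ioi.1 hy)]

lemma transDensity_bound {γ a t x : ℝ} (hγ : 0 < γ) (ha0 : 0 ≤ a) (ha : a < γ / 2)
    (ht : 1 ≤ t) (ht2 : 1 ≤ γ * Real.sqrt (2 * t)) (hx : |x| ≤ a * t) (y : ℝ) :
    |transDensity γ t x y * (2 * Real.exp (-2 * γ * |y|)) - γ * Real.exp (-2 * γ * |y|)| ≤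
      (Real.exp (-(γ * (γ / 2 - a)) * t) +
        γ / 2 * (2 / Real.sqrt Real.pi * Real.exp (1 / 4)) *
          Real.exp (-((γ - a) / 2) * Real.sqrt (2 * t))) * Real.exp (-γ * |y|) := by
  have hs : 0 < Real.sqrt (2 * t) := Real.sqrt_pos.2 (by linarith)
  have hss : Real.sqrt (2 * t) * Real.sqrt (2 * t) = 2 * t := Real.mul_self_sqrt (by linarith)
  have hK : 0 < 2 / Real.sqrt Real.pi * Real.exp (1 / 4) := by positivity
  set K := 2 / Real.sqrt Real.pi * Real.exp (1 / 4) with hKd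
  set z := (|x| + |y| - γ * t) / Real.sqrt (2 * t) with hz
  set A := (1 / (2 * Real.sqrt (2 * Real.pi * t))) *
      Real.exp (γ * (|x| + |y|) - γ ^ 2 / 2 * t - (x - y) ^ 2 / (2 * t)) with hA
  have e1 : transDensity γ t x y * (2 * Real.exp (-2 * γ * |y|)) - γ * Real.exp (-2 * γ * |y|)
      = A * (2 * Real.exp (-2 * γ * |y|)) - γ / 2 * (2 - erfc z) * Real.exp (-2 * γ * |y|) := by
    unfold transDensity
    ring
  have hA0 : 0 ≤ A := by positivity
  have hE : 0 ≤ γ / 2 * (2 - erfc z) := mul_nonneg (by positivity) (erfc_two_sub_nonneg z)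
  have b1 : A * (2 * Real.exp (-2 * γ * |y|)) ≤
      Real.exp (-(γ * (γ / 2 - a)) * t) * Real.exp (-γ * |y|) := by
    have hp : 1 ≤ Real.sqrt (2 * Real.pi * t) := by
      rw [Real.one_le_sqrt]; nlinarith [Real.pi_gt_three]
    have h1 : A ≤ 1 / 2 * Real.exp (γ * (|x| + |y|) - γ ^ 2 / 2 * t - (x - y) ^ 2 / (2 * t)) := by
      refine mul_le_mul_of_nonneg_right ?_ (Real.exp_pos _).le
      exact one_div_le_one_div_of_le (by norm_num) (by linarith)
    calc A * (2 * Real.exp (-2 * γ * |y|)) ≤ (1 / 2 * Real.exp (γ * (|x| + |y|) - γ ^ 2 / 2 * t - (x - y) ^ 2 / (2 * t))) * (2 * Real.exp (-2 * γ * |y|)) :=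
          mul_le_mul_of_nonneg_right h1 (by positivity)
      _ = Real.exp (γ * (|x| + |y|) - γ ^ 2 / 2 * t - (x - y) ^ 2 / (2 * t) + -2 * γ * |y|) := by
          rw [Real.exp_add]; ring
      _ ≤ _ := by
          rw [← Real.exp_add]
          apply Real.exp_le_exp.2
          have : 0 ≤ (x - y) ^ 2 / (2 * t) := by positivity
          nlinarith [mul_le_mul_of_nonneg_left hx hγ.le]
  have b2 : γ / 2 * (2 - erfc z) * Real.exp (-2 * γ * |y|) ≤
      γ / 2 * K * Real.exp (-((γ - a) / 2) * Real.sqrt (2 * t)) * Real.exp (-γ * |y|) := by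
    have hzle : z ≤ -((γ - a) / 2) * Real.sqrt (2 * t) + γ * |y| := by
      rw [hz, div_le_iff₀ hs]
      nlinarith [mul_le_mul_of_nonneg_left ht2 (abs_nonneg y)]
    calc γ / 2 * (2 - erfc z) * Real.exp (-2 * γ * |y|)
        ≤ γ / 2 * (K * Real.exp (-((γ - a) / 2) * Real.sqrt (2 * t) + γ * |y|)) *
            Real.exp (-2 * γ * |y|) := by
          have := (erfc_two_sub_le z).trans
            (mul_le_mul_of_nonneg_left (Real.exp_le_exp.2 hzle) hK.le)
          gcongr
      _ = γ / 2 * K * Real.exp ((-((γ - a) / 2) * Real.sqrt (2 * t) + γ * |y|) +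
            (-2 * γ * |y|)) := by rw [Real.exp_add (_ + _)]; ring
      _ = _ := by
          rw [mul_assoc (γ / 2 * K), ← Real.exp_add]; congr 2; ring
  rw [e1, add_mul]
  have n1 : 0 ≤ A * (2 * Real.exp (-2 * γ * |y|)) := by positivity
  have n2 : 0 ≤ γ / 2 * (2 - erfc z) * Real.exp (-2 * γ * |y|) := by positivity
  rw [abs_le]
  constructor <;> linarith

lemma transDensity_meas (γ t x : ℝ) : Measurable (transDensity γ t x) := by
  unfold transDensity
  have := erfc_antitone.measurable
  refine Measurable.add (by fun_prop) (Measurable.const_mul (this.comp ?_) _)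
  fun_prop

theorem transDensity_tendsto_stationary_uniform (γ a : ℝ) (hγ : 0 < γ)
    (ha0 : 0 ≤ a) (ha : a < γ / 2) (B : Set ℝ) (hB : MeasurableSet B) :
    ∀ ε > 0, ∃ T : ℝ, ∀ t ≥ T, ∀ x : ℝ, |x| ≤ a * t →
      |(∫ y in B, transDensity γ t x y * (2 * Real.exp (-2 * γ * |y|))) -
          ∫ y in B, γ * Real.exp (-2 * γ * |y|)| < ε := by
  intro ε hε
  have hsq : Tendsto (fun t : ℝ => Real.sqrt (2 * t)) atTop atTop :=
    Real.tendsto_sqrt_atTop.comp (tendsto_id.const_mul_atTop two_pos)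
  have hδ : Tendsto (fun t : ℝ => (Real.exp (-(γ * (γ / 2 - a)) * t) +
        γ / 2 * (2 / Real.sqrt Real.pi * Real.exp (1 / 4)) *
          Real.exp (-((γ - a) / 2) * Real.sqrt (2 * t))) * ∫ y : ℝ, Real.exp (-γ * |y|))
      atTop (nhds 0) := by
    have t1 : Tendsto (fun t : ℝ => Real.exp (-(γ * (γ / 2 - a)) * t)) atTop (nhds 0) :=
      Real.tendsto_exp_atBot.comp (tendsto_id.const_mul_atTop_of_neg
        (by have := mul_pos hγ (sub_pos.2 ha); linarith))
    have t2 : Tendsto (fun t : ℝ => Real.exp (-((γ - a) / 2) * Real.sqrt (2 * t)))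
        atTop (nhds 0) :=
      Real.tendsto_exp_atBot.comp (hsq.const_mul_atTop_of_neg (by linarith))
    simpa using (t1.add (t2.const_mul
      (γ / 2 * (2 / Real.sqrt Real.pi * Real.exp (1 / 4))))).mul_const
        (∫ y : ℝ, Real.exp (-γ * |y|))
  obtain ⟨T, hT⟩ := eventually_atTop.1 ((hδ.eventually_lt_const hε).and
    ((eventually_ge_atTop 1).and ((hsq.const_mul_atTop hγ).eventually_ge_atTop 1)))
  refine ⟨T, fun t ht x hx => ?_⟩
  obtain ⟨h1, h2, h3⟩ := hT t ht
  have hb := transDensity_bound hγ ha0 ha h2 h3 hx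
  set δ := Real.exp (-(γ * (γ / 2 - a)) * t) +
        γ / 2 * (2 / Real.sqrt Real.pi * Real.exp (1 / 4)) *
          Real.exp (-((γ - a) / 2) * Real.sqrt (2 * t)) with hδd
  have hδ0 : 0 ≤ δ := by positivity
  have hi := integrable_exp_neg_abs' hγ
  have hi2 : Integrable (fun y : ℝ => γ * Real.exp (-2 * γ * |y|)) := by
    have := (integrable_exp_neg_abs' (c := 2 * γ) (by linarith)).const_mul γ
    simpa using this
  have hm := transDensity_meas γ t x
  have hd : Integrable (fun y : ℝ => transDensity γ t x y * (2 * Real.exp (-2 * γ * |y|)) -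
      γ * Real.exp (-2 * γ * |y|)) := by
    refine (hi.const_mul δ).mono' ?_ (Eventually.of_forall hb)
    exact (Measurable.sub (hm.mul (by fun_prop)) (by fun_prop)).aestronglyMeasurable
  have hp : Integrable (fun y : ℝ => transDensity γ t x y * (2 * Real.exp (-2 * γ * |y|))) := by
    refine (hd.add hi2).congr (Eventually.of_forall fun y => ?_)
    simp only [Pi.add_apply, sub_add_cancel]
  rw [← integral_sub hp.integrableOn hi2.integrableOn]
  calc _ ≤ ∫ y in B, |transDensity γ t x y * (2 * Real.exp (-2 * γ * |y|)) -
      γ * Real.exp (-2 * γ * |y|)| := abs_integral_le_integral_abs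
    _ ≤ ∫ y in B, δ * Real.exp (-γ * |y|) :=
        integral_mono hd.abs.integrableOn (hi.const_mul δ).integrableOn hb
    _ ≤ ∫ y, δ * Real.exp (-γ * |y|) :=
        setIntegral_le_integral (hi.const_mul δ) (Eventually.of_forall fun y => by
          show 0 ≤ δ * Real.exp (-γ * |y|)
          positivity)
    _ = δ * ∫ y : ℝ, Real.exp (-γ * |y|) := integral_const_mul _ _
    _ < ε := h1
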